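/- If Ψ > 4·k^{3/2}, then there exist vectors p^{(1)},…,p^{(k)} ∈ ℝ^k (namely the estimation centers) such that the k-means cost of the partition (P_1,…,P_k) with these centers satisfies Cost({P_i, p^{(i)}}_{i=1}^k) = ∑_{i=1}^k ∑_{u∈P_i} d_u·‖F(u) − p^{(i)}‖² ≤ (1 + 3k/Ψ)·k²/Ψ. -/

import Mathlib

open Finset BigOperators Matrix

namespace SpectralClustering

variable {V : Type} [Fintype V] [DecidableEq V]

/-- Volume of a vertex set: the sum of the degrees of its vertices. -/
def vol (G : SimpleGraph V) [DecidableRel G.Adj] (S : Finset V) : ℕ :=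
  ∑ v ∈ S, G.degree v

/-- Number of edges between two (disjoint) vertex sets. -/
def cut (G : SimpleGraph V) [DecidableRel G.Adj] (S T : Finset V) : ℕ :=
  ∑ u ∈ S, (T.filter fun v => G.Adj u v).card

/-- Conductance `φ(S) = |E(S, V \ S)| / μ(S)`. -/
noncomputable def conductance (G : SimpleGraph V) [DecidableRel G.Adj] (S : Finset V) : ℝ :=
  (cut G S Sᶜ : ℝ) / (vol G S : ℝ)

/-- A `k`-way partition of the vertex set into nonempty blocks. -/
def IsKWayPartition {k : ℕ} (P : Fin k → Finset V) : Prop :=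
  (∀ i, (P i).Nonempty) ∧ (∀ i j, i ≠ j → Disjoint (P i) (P j)) ∧
    (∀ v : V, ∃ i, v ∈ P i)

/-- Maximum conductance over the blocks of a tuple of sets. -/
noncomputable def maxCond (G : SimpleGraph V) [DecidableRel G.Adj] {k : ℕ}
    (P : Fin k → Finset V) : ℝ :=
  ⨆ i, conductance G (P i)

/-- Average conductance of the blocks. -/
noncomputable def avgCond (G : SimpleGraph V) [DecidableRel G.Adj] {k : ℕ}
    (P : Fin k → Finset V) : ℝ :=
  (∑ i, conductance G (P i)) / (k : ℝ)

/-- `P` achieves `ρ̂_avr(k)`: it minimizes the maximum conductance among all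
`k`-way partitions, and among those it has minimal average conductance. -/
def AchievesRhoAvr (G : SimpleGraph V) [DecidableRel G.Adj] {k : ℕ}
    (P : Fin k → Finset V) : Prop :=
  IsKWayPartition P ∧
  (∀ Q : Fin k → Finset V, IsKWayPartition Q → maxCond G P ≤ maxCond G Q) ∧
  (∀ Q : Fin k → Finset V, IsKWayPartition Q → maxCond G Q = maxCond G P →
    avgCond G P ≤ avgCond G Q)

/-- Dot product of two vectors indexed by the vertices. -/
def dotV (x y : V → ℝ) : ℝ := ∑ v, x v * y v

/-- The normalized Laplacian `I - D^{-1/2} A D^{-1/2}`. -/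
noncomputable def normLap (G : SimpleGraph V) [DecidableRel G.Adj] : Matrix V V ℝ :=
  1 - Matrix.diagonal (fun v => (Real.sqrt (G.degree v))⁻¹) * G.adjMatrix ℝ *
      Matrix.diagonal (fun v => (Real.sqrt (G.degree v))⁻¹)

/-- `f` is an orthonormal family of eigenvectors of the normalized Laplacian of `G`
with (sorted) eigenvalues `lam`. -/
structure EigenData (G : SimpleGraph V) [DecidableRel G.Adj]
    (f : Fin (Fintype.card V) → V → ℝ) (lam : Fin (Fintype.card V) → ℝ) : Prop where
  eig : ∀ i, (normLap G).mulVec (f i) = lam i • f i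
  ortho : ∀ i j, dotV (f i) (f j) = if i = j then (1 : ℝ) else 0
  mono : Monotone lam

/-- The gap parameter `Ψ = λ_{k+1} / ρ̂_avr(k)`, where `ρ̂_avr(k)` is realized as the
average conductance of the fixed optimal partition `P`. -/
noncomputable def Psi (G : SimpleGraph V) [DecidableRel G.Adj]
    (lam : Fin (Fintype.card V) → ℝ) {k : ℕ} (P : Fin k → Finset V)
    (hkn : k < Fintype.card V) : ℝ :=
  lam ⟨k, hkn⟩ / avgCond G P

/-- The spectral embedding `F(u) = d_u^{-1/2} (f_1(u), …, f_k(u))`. -/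
noncomputable def Femb (G : SimpleGraph V) [DecidableRel G.Adj]
    (f : Fin (Fintype.card V) → V → ℝ) {k : ℕ} (hk : k ≤ Fintype.card V) (u : V) :
    Fin k → ℝ :=
  fun j => f (Fin.castLE hk j) u / Real.sqrt (G.degree u)

/-- `k`-means cost of a clustering of the (degree-weighted) spectral embedding:
`∑_i ∑_{u ∈ A_i} d_u ‖F(u) - c_i‖²`. -/
noncomputable def kmCost (G : SimpleGraph V) [DecidableRel G.Adj]
    (f : Fin (Fintype.card V) → V → ℝ) {k : ℕ} (hk : k ≤ Fintype.card V) {ℓ : ℕ}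
    (A : Fin ℓ → Finset V) (c : Fin ℓ → Fin k → ℝ) : ℝ :=
  ∑ i, ∑ u ∈ A i, (G.degree u : ℝ) * ∑ j, (Femb G f hk u j - c i j) ^ 2

/-- `Δ_ℓ(𝒳_V)`: the optimal `ℓ`-means cost of the spectral embedding multiset `𝒳_V`
(which contains `d_u` copies of `F(u)` for every vertex `u`). -/
noncomputable def kmOpt (G : SimpleGraph V) [DecidableRel G.Adj]
    (f : Fin (Fintype.card V) → V → ℝ) {k : ℕ} (hk : k ≤ Fintype.card V) (ℓ : ℕ) : ℝ :=
  sInf { r : ℝ | ∃ (A : Fin ℓ → Finset V) (c : Fin ℓ → Fin k → ℝ),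
    (∀ i j, i ≠ j → Disjoint (A i) (A j)) ∧ (∀ v : V, ∃ i, v ∈ A i) ∧
    r = kmCost G f hk A c }

/-- Normalized characteristic vector `ḡ_i = D^{1/2} χ_{P_i} / √μ(P_i)`. -/
noncomputable def gbar (G : SimpleGraph V) [DecidableRel G.Adj] {k : ℕ}
    (P : Fin k → Finset V) (i : Fin k) : V → ℝ :=
  fun v => (if v ∈ P i then Real.sqrt (G.degree v) else 0) / Real.sqrt (vol G (P i))

/-- Coefficients `α_j^{(i)} = ⟨ḡ_i, f_j⟩` of `ḡ_i` in the eigenbasis. -/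
noncomputable def alpha (G : SimpleGraph V) [DecidableRel G.Adj] {k : ℕ}
    (P : Fin k → Finset V) (f : Fin (Fintype.card V) → V → ℝ)
    (i : Fin k) (j : Fin (Fintype.card V)) : ℝ :=
  dotV (gbar G P i) (f j)

/-- Projection `f̂_i = ∑_{j=1}^k α_j^{(i)} f_j` of `ḡ_i` onto the first `k` eigenvectors. -/
noncomputable def fhat (G : SimpleGraph V) [DecidableRel G.Adj] {k : ℕ}
    (P : Fin k → Finset V) (f : Fin (Fintype.card V) → V → ℝ) (i : Fin k) : V → ℝ :=
  fun v => ∑ j : Fin (Fintype.card V),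
    if (j : ℕ) < k then alpha G P f i j * f j v else 0

/-- Estimation center `p^{(i)} = μ(P_i)^{-1/2} (β_i^{(1)}, …, β_i^{(k)})`;
here `beta i j` denotes `β_j^{(i)}`. -/
noncomputable def estCenter (G : SimpleGraph V) [DecidableRel G.Adj] {k : ℕ}
    (P : Fin k → Finset V) (beta : Fin k → Fin k → ℝ) (i : Fin k) : Fin k → ℝ :=
  fun j => beta j i / Real.sqrt (vol G (P i))

/-- The quadratic form of the normalized Laplacian in degree-rescaled coordinates. -/
lemma dotV_normLap_mulVec_sqrt_degree_mul (G : SimpleGraph V) [DecidableRel G.Adj]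
    (hd : ∀ v : V, 0 < G.degree v) (y : V → ℝ) :
    dotV (fun v => √(G.degree v : ℝ) * y v)
        ((normLap G).mulVec fun v => √(G.degree v : ℝ) * y v) =
      ∑ u, ∑ v, G.adjMatrix ℝ u v * (y u * (y u - y v)) := by
  have hs (v : V) : √(G.degree v : ℝ) ≠ 0 :=
    (Real.sqrt_pos.2 (Nat.cast_pos.2 (hd v))).ne'
  refine Finset.sum_congr rfl fun u _ => ?_
  have hdeg : (G.degree u : ℝ) = ∑ v, G.adjMatrix ℝ u v := by
    simp [SimpleGraph.adjMatrix_apply, ← SimpleGraph.card_neighborFinset_eq_degree,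
      SimpleGraph.neighborFinset_eq_filter]
  have hmul : (normLap G).mulVec (fun v => √(G.degree v : ℝ) * y v) u =
      √(G.degree u : ℝ) * y u - ∑ v, (√(G.degree u : ℝ))⁻¹ * (G.adjMatrix ℝ u v * y v) := by
    rw [normLap, Matrix.sub_mulVec, Matrix.one_mulVec, Pi.sub_apply, Matrix.mulVec, dotProduct]
    congr 1
    refine Finset.sum_congr rfl fun v _ => ?_
    rw [Matrix.mul_diagonal, Matrix.diagonal_mul]
    field_simp [hs v]
  have hsq : √(G.degree u : ℝ) * √(G.degree u : ℝ) = ∑ v, G.adjMatrix ℝ u v := by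
    rw [Real.mul_self_sqrt (Nat.cast_nonneg _), hdeg]
  rw [hmul, ← Finset.mul_sum]
  calc _ = (√(G.degree u : ℝ) * √(G.degree u : ℝ)) * (y u * y u) -
        (√(G.degree u : ℝ) * (√(G.degree u : ℝ))⁻¹) *
          (y u * ∑ v, G.adjMatrix ℝ u v * y v) := by ring
    _ = _ := by
      rw [hsq, mul_inv_cancel₀ (hs u), one_mul, Finset.sum_mul, Finset.mul_sum,
        ← Finset.sum_sub_distrib]
      exact Finset.sum_congr rfl fun v _ => by ring

/-- The normalized Laplacian is positive semidefinite. -/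
lemma dotV_normLap_mulVec_nonneg (G : SimpleGraph V) [DecidableRel G.Adj]
    (hd : ∀ v : V, 0 < G.degree v) (x : V → ℝ) :
    0 ≤ dotV x ((normLap G).mulVec x) := by
  obtain ⟨y, rfl⟩ : ∃ y : V → ℝ, x = fun v => √(G.degree v : ℝ) * y v :=
    ⟨fun v => x v / √(G.degree v : ℝ), funext fun v =>
      (mul_div_cancel₀ (x v) (Real.sqrt_pos.2 (Nat.cast_pos.2 (hd v))).ne').symm⟩
  rw [dotV_normLap_mulVec_sqrt_degree_mul G hd]
  have hswap : ∑ u, ∑ v, G.adjMatrix ℝ u v * (y u * (y u - y v)) =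
      ∑ u, ∑ v, G.adjMatrix ℝ u v * (y v * (y v - y u)) := by
    rw [Finset.sum_comm]
    refine Finset.sum_congr rfl fun u _ => Finset.sum_congr rfl fun v _ => ?_
    rw [(G.isSymm_adjMatrix (α := ℝ)).apply]
  have hsum : ∑ u, ∑ v, G.adjMatrix ℝ u v * (y u * (y u - y v)) +
      ∑ u, ∑ v, G.adjMatrix ℝ u v * (y v * (y v - y u)) =
      ∑ u, ∑ v, G.adjMatrix ℝ u v * (y u - y v) ^ 2 := by
    simp only [← Finset.sum_add_distrib]
    exact Finset.sum_congr rfl fun u _ => Finset.sum_congr rfl fun v _ => by ring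
  have hnn : 0 ≤ ∑ u, ∑ v, G.adjMatrix ℝ u v * (y u - y v) ^ 2 :=
    Finset.sum_nonneg fun u _ => Finset.sum_nonneg fun v _ =>
      mul_nonneg (by rw [SimpleGraph.adjMatrix_apply]; split_ifs <;> norm_num) (sq_nonneg _)
  linarith

/-- The Rayleigh quotient of a normalized characteristic vector is the conductance. -/
lemma dotV_gbar_normLap_mulVec (G : SimpleGraph V) [DecidableRel G.Adj]
    (hd : ∀ v : V, 0 < G.degree v) {k : ℕ} (P : Fin k → Finset V) (i : Fin k) :
    dotV (gbar G P i) ((normLap G).mulVec (gbar G P i)) = conductance G (P i) := by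
  have hg : gbar G P i = fun v => √(G.degree v : ℝ) *
      ((if v ∈ P i then 1 else 0) / √(vol G (P i) : ℝ)) := by
    funext v
    simp only [gbar]
    split_ifs <;> ring
  have hvol : √(vol G (P i) : ℝ) * √(vol G (P i) : ℝ) = vol G (P i) :=
    Real.mul_self_sqrt (Nat.cast_nonneg _)
  have hcut : (cut G (P i) (P i)ᶜ : ℝ) = ∑ u, ∑ v, G.adjMatrix ℝ u v *
      ((if u ∈ P i then 1 else 0) * ((if u ∈ P i then 1 else 0) - if v ∈ P i then 1 else 0)) := by
    rw [cut, Nat.cast_sum, ← Finset.sum_subset (Finset.subset_univ (P i))]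
    · refine Finset.sum_congr rfl fun u hu => ?_
      rw [Finset.card_filter, Nat.cast_sum, ← Finset.sum_subset (Finset.subset_univ (P i)ᶜ)]
      · refine Finset.sum_congr rfl fun v hv => ?_
        simp [hu, Finset.mem_compl.1 hv, SimpleGraph.adjMatrix_apply]
      · intro v _ hv
        simp [hu, by simpa using hv]
    · intro u _ hu
      simp [hu]
  rw [hg, dotV_normLap_mulVec_sqrt_degree_mul G hd, conductance, hcut, Finset.sum_div]
  refine Finset.sum_congr rfl fun u _ => ?_
  rw [Finset.sum_div]
  refine Finset.sum_congr rfl fun v _ => ?_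
  rw [← sub_div, div_mul_div_comm, hvol]
  ring

/-- A normalized characteristic vector has unit norm on its block. -/
lemma sum_gbar_sq (G : SimpleGraph V) [DecidableRel G.Adj] (hd : ∀ v : V, 0 < G.degree v)
    {k : ℕ} {P : Fin k → Finset V} {i : Fin k} (hPi : (P i).Nonempty) :
    ∑ u ∈ P i, gbar G P i u ^ 2 = 1 := by
  have hv : (vol G (P i) : ℝ) ≠ 0 :=
    (Nat.cast_pos.2 (Finset.sum_pos (fun v _ => hd v) hPi)).ne'
  have h : ∀ u ∈ P i, gbar G P i u ^ 2 = (G.degree u : ℝ) / vol G (P i) := fun u hu => by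
    simp only [gbar, if_pos hu, div_pow, Real.sq_sqrt (Nat.cast_nonneg _)]
  rw [Finset.sum_congr rfl h, ← Finset.sum_div, ← Nat.cast_sum]
  exact div_self hv

/-- `ḡ_i` is supported on `P_i`, so pairing with it only involves that block. -/
lemma dotV_gbar (G : SimpleGraph V) [DecidableRel G.Adj] {k : ℕ} (P : Fin k → Finset V)
    (i : Fin k) (x : V → ℝ) : dotV (gbar G P i) x = ∑ u ∈ P i, gbar G P i u * x u := by
  refine (Finset.sum_subset (Finset.subset_univ (P i)) fun u _ hu => ?_).symm
  simp [gbar, hu]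

/-- An orthonormal family of eigenvectors indexed by the number of vertices spans. -/
lemma EigenData.sum_dotV_mul {G : SimpleGraph V} [DecidableRel G.Adj]
    {f : Fin (Fintype.card V) → V → ℝ} {lam : Fin (Fintype.card V) → ℝ}
    (hf : EigenData G f lam) (x : V → ℝ) (v : V) : ∑ j, dotV x (f j) * f j v = x v := by
  let M : Matrix (Fin (Fintype.card V)) V ℝ := Matrix.of f
  have h1 : M * Mᵀ = 1 := by
    ext i j
    rw [Matrix.one_apply, ← hf.ortho i j]
    rfl
  have h2 : Mᵀ * M = 1 :=
    (Matrix.mul_eq_one_comm_of_equiv (Fintype.equivFin V).symm).1 h1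
  have h3 (u : V) : ∑ j, f j u * f j v = if u = v then 1 else 0 := by
    have := congrFun (congrFun h2 u) v
    rwa [Matrix.one_apply] at this
  calc ∑ j, dotV x (f j) * f j v = ∑ u, x u * ∑ j, f j u * f j v := by
        simp only [dotV, Finset.sum_mul, Finset.mul_sum]
        rw [Finset.sum_comm]
        exact Finset.sum_congr rfl fun u _ => Finset.sum_congr rfl fun j _ => by ring
    _ = x v := by simp [h3]

/-- Parseval's identity in the eigenbasis. -/
lemma EigenData.sum_dotV_sq {G : SimpleGraph V} [DecidableRel G.Adj]
    {f : Fin (Fintype.card V) → V → ℝ} {lam : Fin (Fintype.card V) → ℝ}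
    (hf : EigenData G f lam) (x : V → ℝ) : ∑ j, dotV x (f j) ^ 2 = dotV x x := by
  calc ∑ j, dotV x (f j) ^ 2 = ∑ u, x u * ∑ j, dotV x (f j) * f j u := by
        simp only [Finset.mul_sum]
        rw [Finset.sum_comm]
        refine Finset.sum_congr rfl fun j _ => ?_
        rw [sq]
        nth_rewrite 2 [dotV]
        rw [Finset.mul_sum]
        exact Finset.sum_congr rfl fun u _ => by ring
    _ = dotV x x := by simp only [hf.sum_dotV_mul]; rfl

/-- The quadratic form of the normalized Laplacian in the eigenbasis. -/
lemma EigenData.sum_lam_mul_dotV_sq {G : SimpleGraph V} [DecidableRel G.Adj]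
    {f : Fin (Fintype.card V) → V → ℝ} {lam : Fin (Fintype.card V) → ℝ}
    (hf : EigenData G f lam) (x : V → ℝ) :
    ∑ j, lam j * dotV x (f j) ^ 2 = dotV x ((normLap G).mulVec x) := by
  have hx : x = ∑ j, dotV x (f j) • f j := by
    funext v
    simp [hf.sum_dotV_mul x v]
  have hL : (normLap G).mulVec x = ∑ j, dotV x (f j) • lam j • f j := by
    conv_lhs => rw [hx]
    rw [Matrix.mulVec_sum]
    exact Finset.sum_congr rfl fun j _ => by rw [Matrix.mulVec_smul, hf.eig]
  rw [hL]
  simp only [dotV, Finset.sum_apply, Pi.smul_apply, smul_eq_mul]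
  simp only [Finset.mul_sum]
  rw [Finset.sum_comm]
  refine Finset.sum_congr rfl fun j _ => ?_
  rw [sq, ← mul_assoc, Finset.mul_sum]
  exact Finset.sum_congr rfl fun v _ => by ring

lemma EigenData.lam_nonneg {G : SimpleGraph V} [DecidableRel G.Adj]
    (hd : ∀ v : V, 0 < G.degree v)
    {f : Fin (Fintype.card V) → V → ℝ} {lam : Fin (Fintype.card V) → ℝ}
    (hf : EigenData G f lam) (j : Fin (Fintype.card V)) : 0 ≤ lam j := by
  have h := dotV_normLap_mulVec_nonneg G hd (f j)
  rw [← hf.sum_lam_mul_dotV_sq] at h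
  simpa [hf.ortho] using h

/-- The energy of `ḡ_i` outside the first `k` eigenvectors is controlled by the conductance. -/
lemma EigenData.lam_mul_one_sub_sum_alpha_sq_le {G : SimpleGraph V} [DecidableRel G.Adj]
    (hd : ∀ v : V, 0 < G.degree v) {k : ℕ} (hkn : k < Fintype.card V)
    {f : Fin (Fintype.card V) → V → ℝ} {lam : Fin (Fintype.card V) → ℝ}
    (hf : EigenData G f lam) {P : Fin k → Finset V} {i : Fin k} (hPi : (P i).Nonempty) :
    lam ⟨k, hkn⟩ * (1 - ∑ j : Fin k, alpha G P f i (Fin.castLE hkn.le j) ^ 2) ≤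
      conductance G (P i) := by
  have hsplit (a : Fin (Fintype.card V) → ℝ) : ∑ j : Fin k, a (Fin.castLE hkn.le j) =
      ∑ j ∈ Finset.univ.filter fun j : Fin (Fintype.card V) => (j : ℕ) < k, a j := by
    refine Finset.sum_bij (fun j _ => Fin.castLE hkn.le j) (fun j _ => by simp)
      (fun a _ b _ h => Fin.castLE_injective _ h) (fun b hb => ?_) (fun _ _ => rfl)
    exact ⟨⟨b, (Finset.mem_filter.1 hb).2⟩, Finset.mem_univ _, rfl⟩
  have hone : ∑ j, alpha G P f i j ^ 2 = 1 := by
    rw [← sum_gbar_sq G hd hPi]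
    simp only [alpha]
    rw [hf.sum_dotV_sq, dotV_gbar]
    exact Finset.sum_congr rfl fun u _ => (sq _).symm
  rw [hsplit fun j => alpha G P f i j ^ 2, ← hone,
    ← Finset.sum_filter_add_sum_filter_not Finset.univ (fun j : Fin _ => (j : ℕ) < k),
    add_sub_cancel_left, Finset.mul_sum, ← dotV_gbar_normLap_mulVec G hd P i,
    ← hf.sum_lam_mul_dotV_sq]
  calc _ ≤ ∑ j ∈ Finset.univ.filter fun j : Fin (Fintype.card V) => ¬ (j : ℕ) < k,
          lam j * alpha G P f i j ^ 2 := by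
        refine Finset.sum_le_sum fun j hj => mul_le_mul_of_nonneg_right (hf.mono ?_) (sq_nonneg _)
        exact not_lt.1 (Finset.mem_filter.1 hj).2
    _ ≤ _ := Finset.sum_le_sum_of_subset_of_nonneg (Finset.filter_subset _ _) fun j _ _ =>
        mul_nonneg (hf.lam_nonneg hd j) (sq_nonneg _)

/-- The `k`-means cost of a partition whose centers are the block means of the embedding. -/
lemma EigenData.kmCost_alpha {G : SimpleGraph V} [DecidableRel G.Adj]
    (hd : ∀ v : V, 0 < G.degree v) {k : ℕ} (hk : k ≤ Fintype.card V)
    {f : Fin (Fintype.card V) → V → ℝ} {lam : Fin (Fintype.card V) → ℝ}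
    (hf : EigenData G f lam) {P : Fin k → Finset V} (hP : IsKWayPartition P) :
    kmCost G f hk P (fun i j => alpha G P f i (Fin.castLE hk j) / √(vol G (P i) : ℝ)) =
      ∑ i, (1 - ∑ j, alpha G P f i (Fin.castLE hk j) ^ 2) := by
  obtain ⟨hne, hdisj, hcov⟩ := hP
  have hblock (i : Fin k) : ∑ u ∈ P i, (G.degree u : ℝ) * ∑ j, (Femb G f hk u j -
      alpha G P f i (Fin.castLE hk j) / √(vol G (P i) : ℝ)) ^ 2 =
      ∑ u ∈ P i, ∑ j, f (Fin.castLE hk j) u ^ 2 -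
        ∑ j, alpha G P f i (Fin.castLE hk j) ^ 2 := by
    have hterm : ∀ u ∈ P i, (G.degree u : ℝ) * ∑ j, (Femb G f hk u j -
        alpha G P f i (Fin.castLE hk j) / √(vol G (P i) : ℝ)) ^ 2 =
        ∑ j, (f (Fin.castLE hk j) u - alpha G P f i (Fin.castLE hk j) * gbar G P i u) ^ 2 := by
      intro u hu
      rw [Finset.mul_sum]
      refine Finset.sum_congr rfl fun j _ => ?_
      have hs : √(G.degree u : ℝ) ≠ 0 := (Real.sqrt_pos.2 (Nat.cast_pos.2 (hd u))).ne'
      have hsq : (G.degree u : ℝ) = √(G.degree u : ℝ) ^ 2 :=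
        (Real.sq_sqrt (Nat.cast_nonneg _)).symm
      simp only [Femb, gbar, if_pos hu]
      rw [hsq, Real.sqrt_sq (Real.sqrt_nonneg _), ← mul_pow, mul_sub, mul_div_cancel₀ _ hs]
      ring
    rw [Finset.sum_congr rfl hterm, Finset.sum_comm, Finset.sum_comm (s := P i),
      ← Finset.sum_sub_distrib]
    refine Finset.sum_congr rfl fun j _ => ?_
    have ha : ∑ u ∈ P i, gbar G P i u * f (Fin.castLE hk j) u =
        alpha G P f i (Fin.castLE hk j) := (dotV_gbar G P i _).symm
    have hexp : ∀ u ∈ P i,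
        (f (Fin.castLE hk j) u - alpha G P f i (Fin.castLE hk j) * gbar G P i u) ^ 2 =
        f (Fin.castLE hk j) u ^ 2 -
          2 * alpha G P f i (Fin.castLE hk j) * (gbar G P i u * f (Fin.castLE hk j) u) +
          alpha G P f i (Fin.castLE hk j) ^ 2 * gbar G P i u ^ 2 := fun u _ => by ring
    rw [Finset.sum_congr rfl hexp, Finset.sum_add_distrib, Finset.sum_sub_distrib,
      ← Finset.mul_sum, ← Finset.mul_sum, ha, sum_gbar_sq G hd (hne i)]
    ring
  have huniv : Finset.univ.biUnion P = Finset.univ := by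
    ext v
    simpa using hcov v
  have htotal : ∑ i, ∑ u ∈ P i, ∑ j, f (Fin.castLE hk j) u ^ 2 = ∑ _i : Fin k, (1 : ℝ) := by
    rw [← Finset.sum_biUnion fun i _ j _ hij => hdisj i j hij, huniv, Finset.sum_comm]
    refine Finset.sum_congr rfl fun j _ => ?_
    have h := hf.ortho (Fin.castLE hk j) (Fin.castLE hk j)
    rw [if_pos rfl] at h
    rw [← h]
    exact Finset.sum_congr rfl fun u _ => sq _
  rw [kmCost, Finset.sum_congr rfl fun i _ => hblock i, Finset.sum_sub_distrib, htotal,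
    ← Finset.sum_sub_distrib]

theorem optimal_partition_has_small_kmeans_cost
    {V : Type} [Fintype V] [DecidableEq V] (G : SimpleGraph V) [DecidableRel G.Adj]
    (hd : ∀ v : V, 0 < G.degree v)
    {k : ℕ} (hkn : k < Fintype.card V)
    (f : Fin (Fintype.card V) → V → ℝ) (lam : Fin (Fintype.card V) → ℝ)
    (hf : EigenData G f lam)
    (P : Fin k → Finset V) (hP : AchievesRhoAvr G P)
    (hPsi : Psi G lam P hkn > 4 * Real.sqrt ((k : ℝ) ^ 3)) :
    ∃ p : Fin k → Fin k → ℝ,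
      kmCost G f hkn.le P p ≤
        (1 + 3 * (k : ℝ) / Psi G lam P hkn) * ((k : ℝ) ^ 2 / Psi G lam P hkn) := by
  obtain ⟨hpart, -, -⟩ := hP
  refine ⟨fun i j => alpha G P f i (Fin.castLE hkn.le j) / √(vol G (P i) : ℝ), ?_⟩
  rw [hf.kmCost_alpha hd hkn.le hpart]
  have hPsi_pos : 0 < Psi G lam P hkn := lt_of_le_of_lt (by positivity) hPsi
  have havg : 0 ≤ avgCond G P := by
    unfold avgCond conductance
    positivity
  have hlam : 0 < lam ⟨k, hkn⟩ := by
    refine (hf.lam_nonneg hd _).lt_of_ne' fun h => ?_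
    simp [Psi, h] at hPsi_pos
  obtain ⟨v⟩ : Nonempty V := Fintype.card_pos_iff.1 (Nat.zero_lt_of_lt hkn)
  obtain ⟨i₀, -⟩ := hpart.2.2 v
  have hk1 : (1 : ℝ) ≤ k := by exact_mod_cast i₀.pos
  have hcost : ∑ i, (1 - ∑ j : Fin k, alpha G P f i (Fin.castLE hkn.le j) ^ 2) ≤
      k / Psi G lam P hkn := by
    have hsum : lam ⟨k, hkn⟩ *
        ∑ i, (1 - ∑ j : Fin k, alpha G P f i (Fin.castLE hkn.le j) ^ 2) ≤ k * avgCond G P := by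
      rw [avgCond, mul_div_cancel₀ _ (by positivity), Finset.mul_sum]
      exact Finset.sum_le_sum fun i _ =>
        hf.lam_mul_one_sub_sum_alpha_sq_le hd hkn (hpart.1 i)
    rw [Psi, div_div_eq_mul_div, le_div_iff₀ hlam]
    linarith
  calc _ ≤ k / Psi G lam P hkn := hcost
    _ ≤ k ^ 2 / Psi G lam P hkn := by gcongr; nlinarith
    _ ≤ _ := le_mul_of_one_le_left (by positivity) (le_add_of_nonneg_right (by positivity))

end SpectralClustering
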